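/- arXiv:2408.12335 — 2 statements merged into one kernel-verified Lean document; each statement's English description precedes it below -/
import Mathlib

section
/- Let q>1, k>0, ν<1/2 and 0<ρ̃<1. Then there exist constants C>0 and K∈ℝ such that for every s ∈ (0,1): s^{1/2} · ∫_{ρ̃}^{∞} exp((k/(2·log q))·(log u)² + ν·log u) · exp(−(k/(2·log q))·(log(u/s))²) · u^{−3/2} du ≤ C · s^{K} · exp(−(k/(2·log q))·(log s)²). -/
open MeasureTheory

/-- The integral estimate bounding the term `I₁` in the proof of Proposition 3.5:
for `q > 1`, `k > 0`, `ν < 1/2` and `0 < ρ̃ < 1`, there are constants `C > 0` and `K ∈ ℝ`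
such that for every `s ∈ (0,1)` the weighted integral over `[ρ̃,∞)` is bounded by
`C s^K exp(-(k/(2 log q)) (log s)²)`, the integral being convergent. -/
theorem stmt2 (q k ν ρ : ℝ) (hq : 1 < q) (hk : 0 < k) (hν : ν < 1 / 2)
    (hρ0 : 0 < ρ) (hρ1 : ρ < 1) :
    ∃ C K : ℝ, 0 < C ∧ ∀ s : ℝ, 0 < s → s < 1 →
      IntegrableOn (fun u : ℝ =>
          Real.exp (k / (2 * Real.log q) * Real.log u ^ 2 + ν * Real.log u) *
            Real.exp (-(k / (2 * Real.log q)) * Real.log (u / s) ^ 2) *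
            u ^ (-(3 : ℝ) / 2)) (Set.Ioi ρ) ∧
      s ^ ((1 : ℝ) / 2) *
          ∫ u in Set.Ioi ρ,
            Real.exp (k / (2 * Real.log q) * Real.log u ^ 2 + ν * Real.log u) *
              Real.exp (-(k / (2 * Real.log q)) * Real.log (u / s) ^ 2) *
              u ^ (-(3 : ℝ) / 2) ≤
        C * s ^ K * Real.exp (-(k / (2 * Real.log q)) * Real.log s ^ 2) := by
  have hlq : 0 < Real.log q := Real.log_pos hq
  have ha : 0 < k / (2 * Real.log q) := by positivity
  generalize k / (2 * Real.log q) = a at ha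
  have hd : 0 < 1 / 2 - ν := by linarith
  refine ⟨ρ ^ (ν - 1 / 2) / (1 / 2 - ν), 1 / 2 + 2 * a * Real.log ρ, by positivity, ?_⟩
  intro s hs0 hs1
  have hL : Real.log s < 0 := Real.log_neg hs0 hs1
  have haL : 2 * a * Real.log s < 0 := by nlinarith
  have he : 2 * a * Real.log s + ν - 3 / 2 < -1 := by linarith
  have heq : Set.EqOn (fun u : ℝ => Real.exp (a * Real.log u ^ 2 + ν * Real.log u) *
            Real.exp (-a * Real.log (u / s) ^ 2) * u ^ (-(3 : ℝ) / 2))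
      (fun u : ℝ => Real.exp (-a * Real.log s ^ 2) * u ^ (2 * a * Real.log s + ν - 3 / 2))
      (Set.Ioi ρ) := by
    intro u hu
    have hu0 : 0 < u := lt_trans hρ0 hu
    simp only
    rw [Real.log_div hu0.ne' hs0.ne', Real.rpow_def_of_pos hu0, Real.rpow_def_of_pos hu0,
      ← Real.exp_add, ← Real.exp_add, ← Real.exp_add]
    congr 1
    ring
  refine ⟨?_, ?_⟩
  · rw [integrableOn_congr_fun heq measurableSet_Ioi]
    exact (integrableOn_Ioi_rpow_of_lt he hρ0).const_mul _
  · rw [setIntegral_congr_fun measurableSet_Ioi heq, integral_const_mul,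
      integral_Ioi_rpow_of_lt he hρ0]
    have h1 : ρ ^ (2 * a * Real.log s + ν - 3 / 2 + 1)
        = ρ ^ (ν - 1 / 2) * s ^ (2 * a * Real.log ρ) := by
      rw [Real.rpow_def_of_pos hρ0, Real.rpow_def_of_pos hρ0, Real.rpow_def_of_pos hs0,
        ← Real.exp_add]
      congr 1
      ring
    have h2 : -ρ ^ (2 * a * Real.log s + ν - 3 / 2 + 1) / (2 * a * Real.log s + ν - 3 / 2 + 1)
        ≤ ρ ^ (ν - 1 / 2) * s ^ (2 * a * Real.log ρ) / (1 / 2 - ν) := by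
      rw [h1, ← neg_div_neg_eq, neg_neg]
      apply div_le_div_of_nonneg_left (by positivity) hd
      linarith
    calc _ ≤ s ^ ((1 : ℝ) / 2) * (Real.exp (-a * Real.log s ^ 2) *
          (ρ ^ (ν - 1 / 2) * s ^ (2 * a * Real.log ρ) / (1 / 2 - ν))) := by gcongr
      _ = _ := by
        rw [Real.rpow_add hs0]
        ring
end

section
/- Let q>1 and κ, k₂ > 0, and set k₁ := κ·k₂/(κ+k₂) (equivalently 1/κ = 1/k₁ − 1/k₂). Let K₄₁ ∈ ℝ and ρ̃ > 0, and define K₄₂ = (k₂/(κ+k₂))·(K₄₁ − 3/2) and K₃₂ = exp((log q/(2(κ+k₂)))·(K₄₁ − 3/2)²). Then for every s ∈ (0,1): s^{1/2} · ∫₀^{ρ̃} exp(−(κ/(2·log q))·(log r)²) · exp(−(k₂/(2·log q))·(log(r/s))²) · r^{K₄₁ − 3/2} dr ≤ ρ̃ · K₃₂ · s^{1/2 + K₄₂} · exp(−(k₁/(2·log q))·(log s)²). -/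
open MeasureTheory

/-- The integral estimate bounding the term `I₆` in the proof of Proposition 3.6:
with `k₁ = κ k₂/(κ+k₂)`, `K₄₂ = (k₂/(κ+k₂))(K₄₁ - 3/2)` and
`K₃₂ = exp((log q/(2(κ+k₂)))(K₄₁ - 3/2)²)`, for every `s ∈ (0,1)` one has
`s^{1/2} ∫₀^{ρ̃} exp(-(κ/(2 log q))(log r)²) exp(-(k₂/(2 log q))(log(r/s))²) r^{K₄₁-3/2} dr
  ≤ ρ̃ K₃₂ s^{1/2+K₄₂} exp(-(k₁/(2 log q))(log s)²)`. -/
theorem stmt3 (q κ k₂ K₄₁ ρ : ℝ) (hq : 1 < q) (hκ : 0 < κ) (hk₂ : 0 < k₂)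
    (hρ : 0 < ρ) :
    ∀ s : ℝ, 0 < s → s < 1 →
      s ^ ((1 : ℝ) / 2) *
          ∫ r in Set.Ioc (0 : ℝ) ρ,
            Real.exp (-(κ / (2 * Real.log q)) * Real.log r ^ 2) *
              Real.exp (-(k₂ / (2 * Real.log q)) * Real.log (r / s) ^ 2) *
              r ^ (K₄₁ - 3 / 2) ≤
        ρ * Real.exp (Real.log q / (2 * (κ + k₂)) * (K₄₁ - 3 / 2) ^ 2) *
          s ^ ((1 : ℝ) / 2 + k₂ / (κ + k₂) * (K₄₁ - 3 / 2)) *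
          Real.exp (-((κ * k₂ / (κ + k₂)) / (2 * Real.log q)) * Real.log s ^ 2) := by
  intro s hs _
  have hL : 0 < Real.log q := Real.log_pos hq
  have hk : 0 < κ + k₂ := by positivity
  have key : ∀ r ∈ Set.Ioc (0 : ℝ) ρ,
      ‖Real.exp (-(κ / (2 * Real.log q)) * Real.log r ^ 2) *
              Real.exp (-(k₂ / (2 * Real.log q)) * Real.log (r / s) ^ 2) *
              r ^ (K₄₁ - 3 / 2)‖ ≤
        Real.exp (Real.log q / (2 * (κ + k₂)) * (K₄₁ - 3 / 2) ^ 2) *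
          s ^ (k₂ / (κ + k₂) * (K₄₁ - 3 / 2)) *
          Real.exp (-((κ * k₂ / (κ + k₂)) / (2 * Real.log q)) * Real.log s ^ 2) := by
    intro r hr
    have hr0 : 0 < r := hr.1
    rw [Real.norm_of_nonneg (by positivity), Real.rpow_def_of_pos hr0, Real.rpow_def_of_pos hs,
      Real.log_div hr0.ne' hs.ne', ← Real.exp_add, ← Real.exp_add, ← Real.exp_add,
      ← Real.exp_add]
    apply Real.exp_le_exp.mpr
    generalize Real.log r = x
    generalize Real.log s = y
    generalize K₄₁ - 3 / 2 = a
    generalize Real.log q = L at *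
    have h : 0 ≤ (κ + k₂) / (2 * L) * (x - (k₂ * y + a * L) / (κ + k₂)) ^ 2 := by positivity
    rw [← sub_nonneg]
    convert h using 1
    field_simp
    ring
  have h := norm_setIntegral_le_of_norm_le_const (μ := volume)
    (measure_Ioc_lt_top (a := (0 : ℝ)) (b := ρ)) key
  have h2 := (le_abs_self _).trans h
  rw [Real.volume_real_Ioc_of_le hρ.le, sub_zero] at h2
  refine (mul_le_mul_of_nonneg_left h2 (by positivity)).trans (le_of_eq ?_)
  rw [Real.rpow_add hs]
  ring
end
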